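/- Let Ã ∈ R^{M×N} be a positive matrix with entries in [a,b], 0 < a ≤ b, and suppose positive vectors x, y satisfy the approximate scaling conditions |(1/c_j)∑_i x_i Ã_{i,j} y_j − 1| ≤ ε and |(1/r_i)∑_j x_i Ã_{i,j} y_j − 1| ≤ ε for all i, j, with ε ∈ (0,1), where r, c are positive with ‖r‖₁ = ‖c‖₁ = s. Then Ã can be scaled to row sums r and column sums c by a pair (x̃, ỹ) satisfying |x̃_i − x_i|/x_i ≤ ε/(1−ε) + 4εs√b/(a² C₁^{3/2} C₂^{3/2} M min_i r_i) and |ỹ_j − y_j|/y_j ≤ ε/(1−ε) + 4εs√b/(a² C₁^{3/2} C₂^{3/2} N min_j c_j) for all i, j, where C₁ = min_i x_i/(r_i/√s) and C₂ = min_j y_j/(c_j/√s). -/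

import Mathlib

open Finset

/-- **Sinkhorn's theorem**: a positive matrix can be scaled to any positive row and column sums
with the same total. -/
theorem exists_scaling {m n : Type*} [Fintype m] [Fintype n] [Nonempty m] [Nonempty n]
    (A : m → n → ℝ) (r : m → ℝ) (c : n → ℝ) (hA : ∀ i j, 0 < A i j)
    (hr : ∀ i, 0 < r i) (hc : ∀ j, 0 < c j) (hrc : ∑ i, r i = ∑ j, c j) :
    ∃ (x : m → ℝ) (y : n → ℝ), (∀ i, 0 < x i) ∧ (∀ j, 0 < y j) ∧
      (∀ i, ∑ j, x i * A i j * y j = r i) ∧ (∀ j, ∑ i, x i * A i j * y j = c j) := by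
  classical
  -- Maximise `∏ y_j ^ c_j / ∏ (A y)_i ^ r_i` over the simplex; it is homogeneous of degree zero.
  let L : m → (n → ℝ) → ℝ := fun i y => ∑ j, A i j * y j
  let G : (n → ℝ) → ℝ := fun y => (∏ j, y j ^ c j) / ∏ i, L i y ^ r i
  have hLpos : ∀ y : n → ℝ, (∀ j, 0 < y j) → ∀ i, 0 < L i y := fun y hy i =>
    sum_pos (fun j _ => mul_pos (hA i j) (hy j)) univ_nonempty
  have hLpos' : ∀ y ∈ stdSimplex ℝ n, ∀ i, 0 < L i y := by
    intro y hy i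
    have h0 : ∀ j ∈ univ, 0 ≤ A i j * y j := fun j _ => mul_nonneg (hA i j).le (hy.1 j)
    refine (sum_nonneg h0).lt_of_ne' fun h => ?_
    have h1 := (sum_eq_zero_iff_of_nonneg h0).1 h
    have h2 : ∑ j, y j = 0 := sum_eq_zero fun j hj =>
      (mul_eq_zero.1 (h1 j hj)).resolve_left (hA i j).ne'
    linarith [hy.2]
  have hGcont : ContinuousOn G (stdSimplex ℝ n) := by
    refine ContinuousOn.div ?_ ?_ ?_
    · refine Continuous.continuousOn (continuous_finsetProd _ fun j _ => ?_)
      exact (continuous_apply j).rpow_const fun _ => Or.inr (hc j).le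
    · refine Continuous.continuousOn (continuous_finsetProd _ fun i _ => ?_)
      exact Continuous.rpow_const (by fun_prop) fun _ => Or.inr (hr i).le
    · exact fun y hy => (prod_pos fun i _ => Real.rpow_pos_of_pos (hLpos' y hy i) _).ne'
  have hGpos : ∀ y : n → ℝ, (∀ j, 0 < y j) → 0 < G y := fun y hy =>
    div_pos (prod_pos fun j _ => Real.rpow_pos_of_pos (hy j) _)
      (prod_pos fun i _ => Real.rpow_pos_of_pos (hLpos y hy i) _)
  have hnorm : ∀ y : n → ℝ, (∀ j, 0 < y j) →
      ∃ z ∈ stdSimplex ℝ n, (∀ j, 0 < z j) ∧ G z = G y := by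
    intro y hy
    have hS : 0 < ∑ j, y j := sum_pos (fun j _ => hy j) univ_nonempty
    set S := ∑ j, y j with hSdef
    refine ⟨fun j => S⁻¹ * y j, ⟨fun j => (mul_pos (inv_pos.2 hS) (hy j)).le, ?_⟩,
      fun j => mul_pos (inv_pos.2 hS) (hy j), ?_⟩
    · rw [← mul_sum, ← hSdef, inv_mul_cancel₀ hS.ne']
    · have h1 : ∏ j, (S⁻¹ * y j) ^ c j = S⁻¹ ^ (∑ j, c j) * ∏ j, y j ^ c j := by
        rw [Real.rpow_sum_of_pos (inv_pos.2 hS), ← prod_mul_distrib]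
        exact prod_congr rfl fun j _ => Real.mul_rpow (inv_pos.2 hS).le (hy j).le
      have h2 : ∏ i, (L i fun j => S⁻¹ * y j) ^ r i
          = S⁻¹ ^ (∑ j, c j) * ∏ i, L i y ^ r i := by
        rw [← hrc, Real.rpow_sum_of_pos (inv_pos.2 hS), ← prod_mul_distrib]
        refine prod_congr rfl fun i _ => ?_
        rw [← Real.mul_rpow (inv_pos.2 hS).le (hLpos y hy i).le]
        congr 1
        simp only [L, mul_sum]
        exact sum_congr rfl fun j _ => by ring
      simp only [G]
      rw [h1, h2, mul_div_mul_left _ _ (Real.rpow_pos_of_pos (inv_pos.2 hS) _).ne']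
  obtain ⟨z₀, hz₀, -, hGz₀⟩ := hnorm (fun _ => 1) fun _ => one_pos
  obtain ⟨y, hyS, hymax⟩ := (isCompact_stdSimplex ℝ n).exists_isMaxOn ⟨z₀, hz₀⟩ hGcont
  have hy : ∀ j, 0 < y j := by
    intro j
    refine (hyS.1 j).lt_of_ne' fun h => ?_
    have hG0 : G y = 0 := by
      have : ∏ j, y j ^ c j = 0 :=
        prod_eq_zero (mem_univ j) (by rw [h, Real.zero_rpow (hc j).ne'])
      simp only [G, this, zero_div]
    have h1 : G z₀ ≤ G y := hymax hz₀
    have h2 := hGpos (fun _ => 1) fun _ => one_pos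
    linarith
  have hmax : ∀ z : n → ℝ, (∀ j, 0 < z j) → G z ≤ G y := by
    intro z hz
    obtain ⟨w, hw, -, hGw⟩ := hnorm z hz
    exact hGw ▸ hymax hw
  have hlogG : ∀ z : n → ℝ, (∀ j, 0 < z j) →
      Real.log (G z) = ∑ j, c j * Real.log (z j) - ∑ i, r i * Real.log (L i z) := by
    intro z hz
    simp only [G]
    rw [Real.log_div (prod_pos fun j _ => Real.rpow_pos_of_pos (hz j) _).ne'
        (prod_pos fun i _ => Real.rpow_pos_of_pos (hLpos z hz i) _).ne',
      Real.log_prod fun j _ => (Real.rpow_pos_of_pos (hz j) _).ne',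
      Real.log_prod fun i _ => (Real.rpow_pos_of_pos (hLpos z hz i) _).ne']
    exact congrArg₂ _ (sum_congr rfl fun j _ => Real.log_rpow (hz j) _)
      (sum_congr rfl fun i _ => Real.log_rpow (hLpos z hz i) _)
  have hcrit : ∀ j, c j / y j = ∑ i, r i * (A i j / L i y) := by
    intro j
    let e : n → ℝ := Pi.single j 1
    have hLe : ∀ i, L i e = A i j := fun i => by simp [L, e, Pi.single_apply]
    have hLadd : ∀ i (t : ℝ), L i (fun k => y k + t * e k) = L i y + t * A i j := by
      intro i t
      rw [← hLe i]
      simp only [L, mul_sum, ← sum_add_distrib]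
      exact sum_congr rfl fun k _ => by ring
    let f : ℝ → ℝ := fun t =>
      ∑ k, c k * Real.log (y k + t * e k) - ∑ i, r i * Real.log (L i y + t * A i j)
    have hlin : ∀ p q : ℝ, HasDerivAt (fun t : ℝ => p + t * q) q 0 := fun p q => by
      simpa using ((hasDerivAt_id (0 : ℝ)).mul_const q).const_add p
    have hder : HasDerivAt f (∑ k, c k * (e k / y k) - ∑ i, r i * (A i j / L i y)) 0 := by
      refine HasDerivAt.sub (HasDerivAt.fun_sum fun k _ => ?_) (HasDerivAt.fun_sum fun i _ => ?_)
      · simpa using ((hlin (y k) (e k)).log (by simpa using (hy k).ne')).const_mul (c k)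
      · simpa using ((hlin (L i y) (A i j)).log
          (by simpa using (hLpos y hy i).ne')).const_mul (r i)
    have hloc : IsLocalMax f 0 := by
      have hev : ∀ᶠ t : ℝ in nhds 0, ∀ k, 0 < y k + t * e k := by
        refine Filter.eventually_all.2 fun k => ?_
        have : Filter.Tendsto (fun t : ℝ => y k + t * e k) (nhds 0) (nhds (y k)) := by
          simpa using (hlin (y k) (e k)).continuousAt.tendsto
        exact this.eventually (lt_mem_nhds (hy k))
      filter_upwards [hev] with t ht
      have h1 : f t = Real.log (G fun k => y k + t * e k) := by
        rw [hlogG _ ht]; simp only [f, hLadd]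
      have h2 : f 0 = Real.log (G y) := by
        rw [hlogG _ hy]; simp [f]
      rw [h1, h2]
      exact Real.log_le_log (hGpos _ ht) (hmax _ ht)
    have h0 := hloc.hasDerivAt_eq_zero hder
    have hsum : ∑ k, c k * (e k / y k) = c j / y j := by
      rw [sum_eq_single j (fun k _ hk => by simp [e, hk]) (by simp)]
      simp [e, div_eq_mul_inv]
    linarith
  refine ⟨fun i => r i / L i y, y, fun i => div_pos (hr i) (hLpos y hy i), hy, fun i => ?_,
    fun j => ?_⟩
  · simp only [mul_assoc]
    rw [← mul_sum]
    exact div_mul_cancel₀ _ (hLpos y hy i).ne'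
  · rw [← sum_mul]
    have h : ∑ i, r i / L i y * A i j = c j / y j := by
      rw [hcrit j]
      exact sum_congr rfl fun i _ => by ring
    rw [h, div_mul_cancel₀ _ (hy j).ne']

theorem sum_bounds_of_abs_le {S r ε : ℝ} (hr : 0 < r) (h : |(1 / r) * S - 1| ≤ ε) :
    (1 - ε) * r ≤ S ∧ S ≤ (1 + ε) * r := by
  have habs := abs_le.1 h
  have hS : (1 / r) * S = S / r := by ring
  constructor
  · exact (le_div_iff₀ hr).1 (by linarith)
  · exact (div_le_iff₀ hr).1 (by linarith)

/-- If a row of sum close to `r` is scaled to have sum `r`, its scaling factor `u` is close to the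
inverse of any lower bound for the other factors, from above. -/
theorem scaling_factor_mul_le {n : Type*} [Fintype n] {p v : n → ℝ} {r ε u l : ℝ}
    (hp : ∀ j, 0 < p j) (hr : 0 < r) (hu : 0 < u) (hl : 0 ≤ l) (hrow : (1 - ε) * r ≤ ∑ j, p j)
    (hscale : u * ∑ j, p j * v j = r) (hv : ∀ j, l ≤ v j) : u * l * (1 - ε) ≤ 1 := by
  have h3 : (∑ j, p j) * l ≤ ∑ j, p j * v j := by
    rw [sum_mul]
    exact sum_le_sum fun j _ => mul_le_mul_of_nonneg_left (hv j) (hp j).le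
  have h4 : u * ((1 - ε) * r * l) ≤ u * ∑ j, p j * v j := by
    gcongr
    exact (mul_le_mul_of_nonneg_right hrow hl).trans h3
  refine le_of_mul_le_mul_right ?_ hr
  linarith

theorem le_scaling_factor_mul {n : Type*} [Fintype n] {p v : n → ℝ} {r ε u h : ℝ}
    (hp : ∀ j, 0 < p j) (hr : 0 < r) (hu : 0 < u) (hh : 0 ≤ h) (hrow : ∑ j, p j ≤ (1 + ε) * r)
    (hscale : u * ∑ j, p j * v j = r) (hv : ∀ j, v j ≤ h) : 1 ≤ u * h * (1 + ε) := by
  have h3 : ∑ j, p j * v j ≤ (∑ j, p j) * h := by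
    rw [sum_mul]
    exact sum_le_sum fun j _ => mul_le_mul_of_nonneg_left (hv j) (hp j).le
  have h4 : u * ∑ j, p j * v j ≤ u * ((1 + ε) * r * h) := by
    gcongr
    exact h3.trans (mul_le_mul_of_nonneg_right hrow hh)
  refine le_of_mul_le_mul_right ?_ hr
  linarith

/-- Bound on the spread of the column factors of a scaling of a nearly scaled matrix whose entries
are at least `k * r i * q j` for a probability vector `q`. -/
theorem scaling_factor_spread {m n : Type*} [Fintype n] {P : m → n → ℝ} {r u : m → ℝ}
    {q v : n → ℝ} {k ε l h : ℝ} {i₀ i₁ : m} (hr : ∀ i, 0 < r i) (hu : ∀ i, 0 < u i)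
    (hq1 : ∑ j, q j = 1) (hlow : ∀ i j, k * r i * q j ≤ P i j) (hl : 0 ≤ l) (hh : 0 ≤ h)
    (hrow : ∀ i, (1 - ε) * r i ≤ ∑ j, P i j) (hrow' : ∀ i, ∑ j, P i j ≤ (1 + ε) * r i)
    (hscale : ∀ i, u i * ∑ j, P i j * v j = r i) (hlv : ∀ j, l ≤ v j) (hvh : ∀ j, v j ≤ h)
    (h₁ : 1 ≤ u i₁ * l * (1 + ε)) (h₀ : u i₀ * h * (1 - ε) ≤ 1) :
    (k - 2 * ε) * h ≤ (k + 2 * ε) * l := by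
  set w := ∑ j, q j * v j with hw
  have hbelow : k * (w - l) ≤ 2 * ε * l := by
    have e1 : k * r i₁ * (w - l) ≤ ∑ j, P i₁ j * v j - (∑ j, P i₁ j) * l := by
      have : k * r i₁ * (w - l) = ∑ j, k * r i₁ * q j * (v j - l) := by
        simp only [mul_sub, sum_sub_distrib, ← sum_mul, ← mul_sum, mul_assoc, hq1, ← hw]
        ring
      rw [this, sum_mul, ← sum_sub_distrib]
      refine sum_le_sum fun j _ => ?_
      rw [← mul_sub]
      exact mul_le_mul_of_nonneg_right (hlow i₁ j) (sub_nonneg.2 (hlv j))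
    have e2 : ∑ j, P i₁ j * v j ≤ r i₁ * (l * (1 + ε)) := by
      refine le_of_mul_le_mul_left ?_ (hu i₁)
      rw [hscale]
      nlinarith [mul_le_mul_of_nonneg_left h₁ (hr i₁).le]
    have e3 := mul_le_mul_of_nonneg_right (hrow i₁) hl
    refine le_of_mul_le_mul_left ?_ (hr i₁)
    linarith
  have habove : k * (h - w) ≤ 2 * ε * h := by
    have e1 : k * r i₀ * (h - w) ≤ (∑ j, P i₀ j) * h - ∑ j, P i₀ j * v j := by
      have : k * r i₀ * (h - w) = ∑ j, k * r i₀ * q j * (h - v j) := by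
        simp only [mul_sub, sum_sub_distrib, ← sum_mul, ← mul_sum, mul_assoc, hq1, ← hw]
        ring
      rw [this, sum_mul, ← sum_sub_distrib]
      refine sum_le_sum fun j _ => ?_
      rw [← mul_sub]
      exact mul_le_mul_of_nonneg_right (hlow i₀ j) (sub_nonneg.2 (hvh j))
    have e2 : r i₀ * (h * (1 - ε)) ≤ ∑ j, P i₀ j * v j := by
      refine le_of_mul_le_mul_left ?_ (hu i₀)
      rw [hscale]
      nlinarith [mul_le_mul_of_nonneg_left h₀ (hr i₀).le]
    have e3 := mul_le_mul_of_nonneg_right (hrow' i₀) hh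
    refine le_of_mul_le_mul_left ?_ (hr i₀)
    linarith
  linarith

/-- The numerical estimate behind the stability bound. -/
theorem abs_sub_one_le_of_balanced {ε k B m w : ℝ} (hε : 0 < ε) (hε1 : ε < 1) (hk : 0 < k)
    (hk1 : k ≤ 1 + ε) (hB : 0 < B) (hBk : 1 ≤ B ^ 2 * k) (hw : 0 < w) (hwm : w ≤ m)
    (hmB : m ≤ B) (hlow : 1 ≤ w * m * (1 + ε))
    (hratio : (k - 2 * ε) * m ^ 2 * (1 - ε) ≤ k + 2 * ε) :
    |w - 1| ≤ ε / (1 - ε) + 4 * (ε / k) * B := by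
  have hε' : 0 < 1 - ε := by linarith
  have hm : 0 < m := hw.trans_le hwm
  set E := ε / (1 - ε) with hE
  have hEε : ε ≤ E := by rw [hE, le_div_iff₀ hε']; nlinarith
  have hE0 : 0 < E := hε.trans_le hEε
  have hE1 : (1 + E) * (1 - ε) = 1 := by rw [hE]; field_simp; ring
  obtain ⟨t, ht⟩ : ∃ t, t = ε / k := ⟨_, rfl⟩
  have htk : ε = t * k := by rw [ht, div_mul_cancel₀ _ hk.ne']
  have ht0 : 0 < t := ht ▸ div_pos hε hk
  rw [← ht]
  rcases le_or_gt 1 (4 * t) with h4 | h4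
  · have h5 : B ≤ 4 * t * B := le_mul_of_one_le_left hB.le h4
    have h6 : 1 ≤ E + B := by
      by_contra! h
      have hb : B < 1 - ε := by linarith
      have : B ^ 2 * k ≤ (1 - ε) ^ 2 * (1 + ε) := by gcongr
      nlinarith [mul_pos hε hε']
    rw [abs_le]
    constructor <;> linarith
  · have hk2 : k ≤ 4 / 3 := by nlinarith
    have hε2 : 3 * ε ≤ 4 * t := by nlinarith
    have hB2 : 17 / 20 ≤ B := by
      by_contra! h
      have : B ^ 2 * k ≤ (17 / 20) ^ 2 * (4 / 3) := by gcongr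
      norm_num at this
      linarith
    have h5 : 17 / 5 * t ≤ 4 * t * B := by nlinarith
    have hr' : (1 - 2 * t) * m ^ 2 * (1 - ε) ≤ 1 + 2 * t := by
      refine le_of_mul_le_mul_left ?_ hk
      have e1 : k * (1 - 2 * t) = k - 2 * ε := by rw [htk]; ring
      have e2 : k * (1 + 2 * t) = k + 2 * ε := by rw [htk]; ring
      rw [e2, ← mul_assoc, ← mul_assoc, e1]
      exact hratio
    have h2t : 0 < 1 - 2 * t := by linarith
    have htt : t ^ 2 ≤ t / 4 := by nlinarith
    rw [abs_le]
    constructor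
    · rcases le_or_gt 1 (ε + 17 / 5 * t) with hD | hD
      · linarith
      · have hwm2 : 1 ≤ w ^ 2 * (m ^ 2 * (1 + ε) ^ 2) := by
          have := one_le_pow₀ hlow (n := 2)
          linarith
        have h6 : (1 - 2 * t) * (1 - ε) ≤ w ^ 2 * ((1 + 2 * t) * (1 + ε) ^ 2) := by
          calc (1 - 2 * t) * (1 - ε)
              ≤ (1 - 2 * t) * (1 - ε) * (w ^ 2 * (m ^ 2 * (1 + ε) ^ 2)) :=
                le_mul_of_one_le_right (by positivity) hwm2
            _ = w ^ 2 * (((1 - 2 * t) * m ^ 2 * (1 - ε)) * (1 + ε) ^ 2) := by ring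
            _ ≤ _ := by gcongr
        have h7 : (1 - 17 / 5 * t) ^ 2 * (1 + 2 * t) ≤ (1 - 2 * t) * (1 - ε) := by
          have e1 : 0 ≤ t * (22 / 15 + 353 / 75 * t - 578 / 25 * t ^ 2) :=
            mul_nonneg ht0.le (by linarith)
          have e2 : (1 - 2 * t) * (1 - 4 / 3 * t) ≤ (1 - 2 * t) * (1 - ε) :=
            mul_le_mul_of_nonneg_left (by linarith) h2t.le
          linarith
        have h8 : (1 - 17 / 5 * t) ^ 2 ≤ (w * (1 + ε)) ^ 2 := by
          refine le_of_mul_le_mul_right ?_ (show 0 < 1 + 2 * t by linarith)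
          linarith
        have h9 : 1 - 17 / 5 * t ≤ w * (1 + ε) := le_of_sq_le_sq h8 (by positivity)
        have hDw : 1 - ε - 17 / 5 * t ≤ w := by
          refine le_of_mul_le_mul_right ?_ (show 0 < 1 + ε by linarith)
          have := mul_pos hε ht0
          have := mul_pos hε hε
          linarith
        linarith
    · have hE2 : E ≤ 1 / 2 := by
        rw [hE, div_le_iff₀ hε']
        linarith
      have h8 : (1 + E) * (1 + 34 / 5 * t + 7 * t ^ 2) ≤ (1 + E + 17 / 5 * t) ^ 2 := by
        have := mul_pos hE0 hE0
        have := mul_le_mul_of_nonneg_right hE2 (sq_nonneg t)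
        linarith [sq_nonneg t]
      have h9 : (1 - 2 * t) * m ^ 2 ≤ (1 + 2 * t) * (1 + E) := by
        refine le_of_mul_le_mul_right ?_ hε'
        rw [mul_assoc (1 + 2 * t), hE1]
        linarith
      have h10 : 1 + 2 * t ≤ (1 - 2 * t) * (1 + 34 / 5 * t + 7 * t ^ 2) := by
        have : 0 ≤ t * (14 / 5 - 33 / 5 * t - 14 * t ^ 2) := mul_nonneg ht0.le (by linarith)
        linarith
      have h11 : m ^ 2 ≤ (1 + E) * (1 + 34 / 5 * t + 7 * t ^ 2) := by
        refine le_of_mul_le_mul_left ?_ h2t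
        have := mul_le_mul_of_nonneg_right h10 (show 0 ≤ 1 + E by linarith)
        linarith
      have h6 : m ≤ 1 + E + 17 / 5 * t := le_of_sq_le_sq (h11.trans h8) (by positivity)
      linarith

/-- A scaling normalised so that the relative factors with respect to `x` and `y` have the same
maximum `μ`. -/
theorem exists_balanced_scaling {m n : Type*} [Fintype m] [Fintype n] [Nonempty m] [Nonempty n]
    (A : m → n → ℝ) (r x : m → ℝ) (c y : n → ℝ) (hA : ∀ i j, 0 < A i j)
    (hr : ∀ i, 0 < r i) (hc : ∀ j, 0 < c j) (hrc : ∑ i, r i = ∑ j, c j)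
    (hx : ∀ i, 0 < x i) (hy : ∀ j, 0 < y j) :
    ∃ (xt : m → ℝ) (yt : n → ℝ) (μ : ℝ), (∀ i, 0 < xt i) ∧ (∀ j, 0 < yt j) ∧
      (∀ i, ∑ j, xt i * A i j * yt j = r i) ∧ (∀ j, ∑ i, xt i * A i j * yt j = c j) ∧
      (∀ i, xt i / x i ≤ μ) ∧ (∀ j, yt j / y j ≤ μ) ∧
      (∃ i, xt i / x i = μ) ∧ (∃ j, yt j / y j = μ) := by
  obtain ⟨xs, ys, hxs, hys, hrow, hcol⟩ := exists_scaling A r c hA hr hc hrc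
  obtain ⟨i₁, hi₁⟩ := Finite.exists_max fun i => xs i / x i
  obtain ⟨j₁, hj₁⟩ := Finite.exists_max fun j => ys j / y j
  set p := xs i₁ / x i₁ with hp
  set q := ys j₁ / y j₁ with hq
  have hp0 : 0 < p := div_pos (hxs _) (hx _)
  have hq0 : 0 < q := div_pos (hys _) (hy _)
  obtain ⟨t, ht0, ht⟩ : ∃ t : ℝ, 0 < t ∧ t * p = q / t := by
    refine ⟨√(q / p), by positivity, ?_⟩
    have h : √(q / p) * √(q / p) = q / p := Real.mul_self_sqrt (by positivity)
    rw [eq_div_iff (by positivity), mul_right_comm, h, div_mul_cancel₀ _ hp0.ne']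
  have hxt : ∀ i, t * xs i / x i = t * (xs i / x i) := fun i => by ring
  have hyt : ∀ j, ys j / t / y j = ys j / y j / t := fun j => by ring
  have hcancel : ∀ i j, t * xs i * A i j * (ys j / t) = xs i * A i j * ys j := fun i j => by
    field_simp
  refine ⟨fun i => t * xs i, fun j => ys j / t, t * p, fun i => mul_pos ht0 (hxs i),
    fun j => div_pos (hys j) ht0, ?_, ?_, ?_, ?_, ⟨i₁, hxt i₁⟩, ⟨j₁, ?_⟩⟩
  · simpa only [hcancel] using hrow
  · simpa only [hcancel] using hcol
  · intro i
    rw [hxt]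
    exact mul_le_mul_of_nonneg_left (hi₁ i) ht0.le
  · intro j
    rw [hyt, ht]
    exact div_le_div_of_nonneg_right (hj₁ j) ht0.le
  · rw [hyt, ht]

/-- A scaling of a matrix with entries in `[a, b]`, relative to reference vectors bounded below by
multiples of `r` and `c`, cannot have large factors on both sides. -/
theorem scaling_factors_mul_le {m n : Type*} [Fintype m] [Fintype n]
    {A : m → n → ℝ} {r x xt : m → ℝ} {c y yt : n → ℝ} {a b s C₁ C₂ μ ν : ℝ} {i : m} {j : n}
    (ha : 0 < a) (hA : ∀ i j, a ≤ A i j ∧ A i j ≤ b) (hr : ∀ i, 0 < r i) (hc : ∀ j, 0 < c j)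
    (hs : ∑ i, r i = s) (hC₂ : 0 < C₂) (hx : C₁ * (r i / √s) ≤ x i)
    (hy : C₂ * (c j / √s) ≤ y j) (hxt : ∀ i, 0 < xt i) (hyt : ∀ j, 0 < yt j)
    (hrow : ∀ i, ∑ j, xt i * A i j * yt j = r i) (hcol : ∀ j, ∑ i, xt i * A i j * yt j = c j)
    (hμ0 : 0 < μ) (hν0 : 0 < ν) (hμ : μ * x i ≤ xt i) (hν : ν * y j ≤ yt j) :
    μ * ν * (a ^ 2 * (C₁ * C₂)) ≤ b := by
  set X := ∑ i, xt i with hX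
  set Y := ∑ j, yt j with hY
  have hX0 : 0 < X := sum_pos (fun i _ => hxt i) ⟨i, mem_univ i⟩
  have hY0 : 0 < Y := sum_pos (fun j _ => hyt j) ⟨j, mem_univ j⟩
  have hs0 : 0 < s := hs ▸ sum_pos (fun i _ => hr i) ⟨i, mem_univ i⟩
  have hss : √s * √s = s := Real.mul_self_sqrt hs0.le
  have hs1 : 0 < √s := Real.sqrt_pos.2 hs0
  have h1 : xt i * (a * Y) ≤ r i := by
    rw [← hrow i, hY, mul_sum, mul_sum]
    refine sum_le_sum fun j _ => ?_
    rw [← mul_assoc]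
    exact mul_le_mul_of_nonneg_right (mul_le_mul_of_nonneg_left (hA i j).1 (hxt i).le) (hyt j).le
  have h2 : yt j * (a * X) ≤ c j := by
    rw [← hcol j, hX, mul_sum, mul_sum]
    refine sum_le_sum fun i _ => ?_
    nlinarith [mul_le_mul_of_nonneg_left (hA i j).1 (mul_pos (hxt i) (hyt j)).le]
  have h3 : s ≤ b * (X * Y) := by
    rw [← hs, hX, sum_mul, mul_sum]
    refine sum_le_sum fun i _ => ?_
    rw [← hrow i, hY, mul_sum, mul_sum]
    refine sum_le_sum fun j _ => ?_
    nlinarith [mul_le_mul_of_nonneg_left (hA i j).2 (mul_pos (hxt i) (hyt j)).le]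
  have key : ∀ {C z ζ ρ w T : ℝ}, 0 < ρ → 0 < T → 0 < w → C * (ρ / √s) ≤ z →
      w * z ≤ ζ → ζ * (a * T) ≤ ρ → w * C * (a * T) ≤ √s := by
    intro C z ζ ρ w T hρ hT hw hz hwz hζ
    have e1 : w * (C * (ρ / √s)) * (a * T) ≤ ρ :=
      (mul_le_mul_of_nonneg_right ((mul_le_mul_of_nonneg_left hz hw.le).trans hwz)
        (by positivity)).trans hζ
    have e2 : w * (C * (ρ / √s)) * (a * T) = w * C * (a * T) * ρ / √s := by ring
    rw [e2, div_le_iff₀ hs1, mul_comm ρ] at e1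
    exact le_of_mul_le_mul_right e1 hρ
  have h4 := key (hr i) hY0 hμ0 hx hμ h1
  have h5 := key (hc j) hX0 hν0 hy hν h2
  have h6 : (μ * C₁ * (a * Y)) * (ν * C₂ * (a * X)) ≤ √s * √s :=
    mul_le_mul h4 h5 (by positivity) hs1.le
  refine le_of_mul_le_mul_right ?_ (mul_pos hX0 hY0)
  linarith

theorem exists_scaling_near {m n : Type*} [Fintype m] [Fintype n] [Nonempty m] [Nonempty n]
    {A : m → n → ℝ} {r x : m → ℝ} {c y : n → ℝ} {a b s ε C₁ C₂ : ℝ} (ha : 0 < a) (hab : a ≤ b)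
    (hA : ∀ i j, a ≤ A i j ∧ A i j ≤ b) (hr : ∀ i, 0 < r i) (hc : ∀ j, 0 < c j)
    (hs_r : ∑ i, r i = s) (hs_c : ∑ j, c j = s) (hx : ∀ i, 0 < x i) (hy : ∀ j, 0 < y j)
    (hε : 0 < ε) (hε1 : ε < 1)
    (hcolε : ∀ j, |(1 / c j) * ∑ i, x i * A i j * y j - 1| ≤ ε)
    (hrowε : ∀ i, |(1 / r i) * ∑ j, x i * A i j * y j - 1| ≤ ε)
    (hC₁ : 0 < C₁) (hC₂ : 0 < C₂) (hxC : ∀ i, C₁ * (r i / √s) ≤ x i)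
    (hyC : ∀ j, C₂ * (c j / √s) ≤ y j) :
    ∃ (xt : m → ℝ) (yt : n → ℝ), (∀ i, 0 < xt i) ∧ (∀ j, 0 < yt j) ∧
      (∀ i, ∑ j, xt i * A i j * yt j = r i) ∧ (∀ j, ∑ i, xt i * A i j * yt j = c j) ∧
      (∀ i, |xt i - x i| / x i ≤
        ε / (1 - ε) + 4 * (ε / (a * (C₁ * C₂))) * (√b / (a * √(C₁ * C₂)))) ∧
      (∀ j, |yt j - y j| / y j ≤
        ε / (1 - ε) + 4 * (ε / (a * (C₁ * C₂))) * (√b / (a * √(C₁ * C₂)))) := by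
  have hA0 : ∀ i j, 0 < A i j := fun i j => ha.trans_le (hA i j).1
  have hb : 0 < b := ha.trans_le hab
  have hs0 : 0 < s := hs_r ▸ sum_pos (fun i _ => hr i) univ_nonempty
  have hss : √s * √s = s := Real.mul_self_sqrt hs0.le
  have hs1 : 0 < √s := Real.sqrt_pos.2 hs0
  obtain ⟨xt, yt, μ, hxt, hyt, hrow, hcol, hxμ, hyμ, ⟨i₁, hi₁⟩, ⟨j₁, hj₁⟩⟩ :=
    exists_balanced_scaling A r x c y hA0 hr hc (hs_r.trans hs_c.symm) hx hy
  refine ⟨xt, yt, hxt, hyt, hrow, hcol, ?_⟩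
  let P : m → n → ℝ := fun i j => x i * A i j * y j
  let u : m → ℝ := fun i => xt i / x i
  let v : n → ℝ := fun j => yt j / y j
  have hP : ∀ i j, 0 < P i j := fun i j => mul_pos (mul_pos (hx i) (hA0 i j)) (hy j)
  have hu : ∀ i, 0 < u i := fun i => div_pos (hxt i) (hx i)
  have hv : ∀ j, 0 < v j := fun j => div_pos (hyt j) (hy j)
  have hμ0 : 0 < μ := hi₁ ▸ hu i₁
  have hprod : ∀ i j, u i * P i j * v j = xt i * A i j * yt j := fun i j => by
    have := (hx i).ne'
    have := (hy j).ne'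
    simp only [u, v, P]
    field_simp
  have hscale_r : ∀ i, u i * ∑ j, P i j * v j = r i := fun i => by
    simp only [mul_sum, ← mul_assoc, hprod, hrow]
  have hscale_c : ∀ j, v j * ∑ i, P i j * u i = c j := fun j => by
    rw [mul_sum, ← hcol j]
    exact sum_congr rfl fun i _ => by rw [← hprod]; ring
  have hr_bd := fun i => sum_bounds_of_abs_le (hr i) (hrowε i)
  have hc_bd := fun j => sum_bounds_of_abs_le (hc j) (hcolε j)
  set k := a * (C₁ * C₂) with hk
  have hk0 : 0 < k := by positivity
  have hlow : ∀ i j, k * r i * (c j / s) ≤ P i j := by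
    intro i j
    have e1 : k * r i * (c j / s) = C₁ * (r i / √s) * a * (C₂ * (c j / √s)) := by
      rw [hk, ← hss]; field_simp; rw [Real.sq_sqrt (by positivity)]
    have := hr i
    have := hc j
    have := hx i
    rw [e1]
    exact mul_le_mul (mul_le_mul (hxC i) (hA i j).1 ha.le (hx i).le) (hyC j) (by positivity)
      (mul_pos (hx i) (hA0 i j)).le
  have hq : ∑ j, c j / s = 1 := by rw [← sum_div, hs_c, div_self hs0.ne']
  have hk1 : k ≤ 1 + ε := by
    refine le_of_mul_le_mul_right ?_ (hr i₁)
    refine le_trans ?_ (hr_bd i₁).2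
    calc k * r i₁ = ∑ j, k * r i₁ * (c j / s) := by rw [← mul_sum, hq, mul_one]
      _ ≤ _ := sum_le_sum fun j _ => hlow i₁ j
  set B := √b / (a * √(C₁ * C₂)) with hB
  have hB0 : 0 < B := by positivity
  have hB2 : B ^ 2 = b / (a ^ 2 * (C₁ * C₂)) := by
    rw [hB, div_pow, mul_pow, Real.sq_sqrt hb.le, Real.sq_sqrt (by positivity)]
  have hBk : 1 ≤ B ^ 2 * k := by
    have : B ^ 2 * k = b / a := by rw [hB2, hk]; field_simp
    rw [this]
    exact (one_le_div ha).2 hab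
  have hμB : μ ≤ B := by
    refine le_of_sq_le_sq ?_ hB0.le
    rw [hB2, le_div_iff₀ (by positivity), sq]
    exact scaling_factors_mul_le ha hA hr hc hs_r hC₂ (hxC i₁) (hyC j₁) hxt hyt hrow hcol hμ0
      hμ0 ((eq_div_iff (hx i₁).ne').1 hi₁.symm).le ((eq_div_iff (hy j₁).ne').1 hj₁.symm).le
  have hulow : ∀ i, 1 ≤ u i * μ * (1 + ε) := fun i =>
    le_scaling_factor_mul (hP i) (hr i) (hu i) hμ0.le (hr_bd i).2 (hscale_r i) hyμ
  have hvlow : ∀ j, 1 ≤ v j * μ * (1 + ε) := fun j =>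
    le_scaling_factor_mul (p := fun i => P i j) (fun i => hP i j) (hc j) (hv j) hμ0.le (hc_bd j).2
      (hscale_c j) hxμ
  have hratio : (k - 2 * ε) * μ ^ 2 * (1 - ε) ≤ k + 2 * ε := by
    obtain ⟨i₀, hi₀⟩ := Finite.exists_min u
    obtain ⟨j₀, hj₀⟩ := Finite.exists_min v
    have e0 : v j₁ * u i₀ * (1 - ε) ≤ 1 :=
      scaling_factor_mul_le (p := fun i => P i j₁) (fun i => hP i j₁) (hc j₁) (hv j₁) (hu i₀).le
        (hc_bd j₁).1 (hscale_c j₁) hi₀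
    have e1 : u i₁ * v j₀ * (1 - ε) ≤ 1 :=
      scaling_factor_mul_le (hP i₁) (hr i₁) (hu i₁) (hv j₀).le (hr_bd i₁).1 (hscale_r i₁) hj₀
    have hu₁ : u i₁ = μ := hi₁
    have hv₁ : v j₁ = μ := hj₁
    rw [hu₁] at e1
    rw [hv₁, mul_comm μ] at e0
    have e2 : 1 ≤ u i₁ * v j₀ * (1 + ε) := by
      rw [hu₁, mul_comm μ]
      exact hvlow j₀
    have e3 := scaling_factor_spread hr hu hq hlow (hv j₀).le hμ0.le (fun i => (hr_bd i).1)
      (fun i => (hr_bd i).2) hscale_r hj₀ hyμ e2 e0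
    have hε' : 0 < 1 - ε := by linarith
    have e4 := mul_le_mul_of_nonneg_right e3 (mul_pos hμ0 hε').le
    have e5 := mul_le_mul_of_nonneg_left e1 (show 0 ≤ k + 2 * ε by positivity)
    linarith
  have hrel : ∀ {z w : ℝ}, 0 < w → |z - w| / w = |z / w - 1| := by
    intro z w hw
    rw [div_sub_one hw.ne', abs_div, abs_of_pos hw]
  refine ⟨fun i => ?_, fun j => ?_⟩
  · rw [hrel (hx i)]
    exact abs_sub_one_le_of_balanced hε hε1 hk0 hk1 hB0 hBk (hu i) (hxμ i) hμB (hulow i) hratio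
  · rw [hrel (hy j)]
    exact abs_sub_one_le_of_balanced hε hε1 hk0 hk1 hB0 hBk (hv j) (hyμ j) hμB (hvlow j) hratio

theorem rpow_three_halves {z : ℝ} (hz : 0 < z) : z ^ ((3 : ℝ) / 2) = z * √z := by
  rw [show (3 : ℝ) / 2 = 1 + 1 / 2 by norm_num, Real.rpow_add hz, Real.rpow_one, Real.sqrt_eq_rpow]

/-- The minimum of a positive function on a finite type is positive. -/
theorem iInf_pos_of_finite {ι : Type*} [Finite ι] [Nonempty ι] {f : ι → ℝ} (hf : ∀ i, 0 < f i) :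
    0 < ⨅ i, f i := by
  obtain ⟨i, hi⟩ := exists_eq_ciInf_of_finite (f := f)
  exact hi ▸ hf i

theorem card_mul_iInf_le_sum {d : ℕ} (f : Fin d → ℝ) : d * ⨅ i, f i ≤ ∑ i, f i := by
  have := card_nsmul_le_sum univ f (⨅ i, f i) fun i _ => ciInf_le (Set.finite_range f).bddBelow i
  simpa using this

theorem scaling_bound_le {a b s ε C₁ C₂ K : ℝ} (ha : 0 < a) (hε : 0 ≤ ε) (hC₁ : 0 < C₁)
    (hC₂ : 0 < C₂) (hK : 0 < K) (hKs : K ≤ s) :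
    4 * (ε / (a * (C₁ * C₂))) * (√b / (a * √(C₁ * C₂))) ≤
      4 * ε * s * √b / (a ^ 2 * C₁ ^ ((3 : ℝ) / 2) * C₂ ^ ((3 : ℝ) / 2) * K) := by
  rw [rpow_three_halves hC₁, rpow_three_halves hC₂, Real.sqrt_mul hC₁.le]
  set W := 4 * (ε / (a * (C₁ * C₂))) * (√b / (a * (√C₁ * √C₂))) with hW
  have hW0 : 0 ≤ W := by positivity
  have h : 4 * ε * s * √b / (a ^ 2 * (C₁ * √C₁) * (C₂ * √C₂) * K) = W * (s / K) := by
    rw [hW]; field_simp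
  rw [h]
  exact le_mul_of_one_le_right hW0 ((one_le_div hK).2 hKs)

theorem stability_of_scaling_factors
    (M N : ℕ) (hM : 0 < M) (hN : 0 < N)
    (At : Fin M → Fin N → ℝ) (a b s ε : ℝ)
    (x : Fin M → ℝ) (y : Fin N → ℝ) (r : Fin M → ℝ) (c : Fin N → ℝ)
    (ha : 0 < a) (hab : a ≤ b)
    (hA : ∀ i j, a ≤ At i j ∧ At i j ≤ b)
    (hr : ∀ i, 0 < r i) (hc : ∀ j, 0 < c j)
    (hs_r : ∑ i, r i = s) (hs_c : ∑ j, c j = s)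
    (hx : ∀ i, 0 < x i) (hy : ∀ j, 0 < y j)
    (hε : ε ∈ Set.Ioo (0 : ℝ) 1)
    (hcolε : ∀ j, |(1 / c j) * ∑ i, x i * At i j * y j - 1| ≤ ε)
    (hrowε : ∀ i, |(1 / r i) * ∑ j, x i * At i j * y j - 1| ≤ ε) :
    ∃ (xt : Fin M → ℝ) (yt : Fin N → ℝ),
      (∀ i, 0 < xt i) ∧ (∀ j, 0 < yt j) ∧
      (∀ i, ∑ j, xt i * At i j * yt j = r i) ∧
      (∀ j, ∑ i, xt i * At i j * yt j = c j) ∧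
      (∀ i, |xt i - x i| / x i ≤
        ε / (1 - ε) + 4 * ε * s * Real.sqrt b /
          (a ^ 2 * (⨅ i', x i' / (r i' / Real.sqrt s)) ^ ((3 : ℝ) / 2) *
            (⨅ j', y j' / (c j' / Real.sqrt s)) ^ ((3 : ℝ) / 2) *
            (M * ⨅ i', r i'))) ∧
      (∀ j, |yt j - y j| / y j ≤
        ε / (1 - ε) + 4 * ε * s * Real.sqrt b /
          (a ^ 2 * (⨅ i', x i' / (r i' / Real.sqrt s)) ^ ((3 : ℝ) / 2) *
            (⨅ j', y j' / (c j' / Real.sqrt s)) ^ ((3 : ℝ) / 2) *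
            (N * ⨅ j', c j'))) := by
  have : Nonempty (Fin M) := ⟨⟨0, hM⟩⟩
  have : Nonempty (Fin N) := ⟨⟨0, hN⟩⟩
  have hs0 : 0 < s := hs_r ▸ sum_pos (fun i _ => hr i) univ_nonempty
  have hs1 : 0 < √s := Real.sqrt_pos.2 hs0
  have hrs : ∀ i, 0 < r i / √s := fun i => div_pos (hr i) hs1
  have hcs : ∀ j, 0 < c j / √s := fun j => div_pos (hc j) hs1
  have hC₁ := iInf_pos_of_finite fun i => div_pos (hx i) (hrs i)
  have hC₂ := iInf_pos_of_finite fun j => div_pos (hy j) (hcs j)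
  have hM' : (0 : ℝ) < M := Nat.cast_pos.2 hM
  have hN' : (0 : ℝ) < N := Nat.cast_pos.2 hN
  obtain ⟨xt, yt, hxt, hyt, hrow, hcol, hxb, hyb⟩ :=
    exists_scaling_near ha hab hA hr hc hs_r hs_c hx hy hε.1 hε.2 hcolε hrowε hC₁ hC₂
      (fun i => (le_div_iff₀ (hrs i)).1 (ciInf_le (Set.finite_range _).bddBelow i))
      (fun j => (le_div_iff₀ (hcs j)).1 (ciInf_le (Set.finite_range _).bddBelow j))
  refine ⟨xt, yt, hxt, hyt, hrow, hcol, fun i => (hxb i).trans ?_, fun j => (hyb j).trans ?_⟩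
  · exact add_le_add_right (scaling_bound_le ha hε.1.le hC₁ hC₂
      (mul_pos hM' (iInf_pos_of_finite hr)) (hs_r ▸ card_mul_iInf_le_sum r)) _
  · exact add_le_add_right (scaling_bound_le ha hε.1.le hC₁ hC₂
      (mul_pos hN' (iInf_pos_of_finite hc)) (hs_c ▸ card_mul_iInf_le_sum c)) _
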